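/- Let g : ℝ → [0,∞) be continuous with g = 0 on (-∞,0] and g locally Lipschitz where positive, and l > -1/2. Then for every ẙ > 0 the integral equation y(r) = ẙ - ∫₀ʳ (1/s²)(4π ∫₀ˢ t^(2+2l) g(y(t)) dt) ds has a unique solution y ∈ C¹([0,∞)). This solution is nonincreasing, satisfies y'(0) = 0, and y(r) ≤ ẙ for all r. -/

import Mathlib

open Real MeasureTheory Set Filter

open Topology

/-- `m(s) / s²`, where `m(s)` is the mass in the ball of radius `s` generated by `h`. -/
noncomputable def field (l : ℝ) (h : ℝ → ℝ) (s : ℝ) : ℝ :=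
  (4 * π * ∫ t in (0:ℝ)..s, t ^ (2 + 2*l) * h t) / s ^ 2

/-- The potential with central value `a` generated by `h`. -/
noncomputable def potential (l a : ℝ) (h : ℝ → ℝ) (r : ℝ) : ℝ :=
  a - ∫ s in (0:ℝ)..r, field l h s

/-- Measurable sources on the half line with values in `[0, C]`. -/
structure BoundedSource (C : ℝ) (h : ℝ → ℝ) : Prop where
  aemeasurable : AEMeasurable h (volume.restrict (Ici 0))
  nonneg : ∀ t ≥ (0:ℝ), 0 ≤ h t
  le : ∀ t ≥ (0:ℝ), h t ≤ C

section
variable {l a C : ℝ} {h h₁ h₂ : ℝ → ℝ}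

lemma field_zero : field l h 0 = 0 := by simp [field]

lemma potential_zero : potential l a h 0 = a := by simp [potential]

lemma field_nonneg (hh : ∀ t ≥ (0:ℝ), 0 ≤ h t) {s : ℝ} (hs : 0 ≤ s) : 0 ≤ field l h s := by
  have : 0 ≤ ∫ t in (0:ℝ)..s, t ^ (2 + 2*l) * h t :=
    intervalIntegral.integral_nonneg hs fun t ht =>
      mul_nonneg (rpow_nonneg ht.1 _) (hh t ht.1)
  unfold field
  positivity

lemma potential_le (hh : ∀ t ≥ (0:ℝ), 0 ≤ h t) {r : ℝ} (hr : 0 ≤ r) :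
    potential l a h r ≤ a := by
  have : 0 ≤ ∫ s in (0:ℝ)..r, field l h s :=
    intervalIntegral.integral_nonneg hr fun t ht => field_nonneg hh ht.1
  unfold potential
  linarith

lemma field_congr {s : ℝ} (hs : 0 ≤ s) (heq : ∀ t ∈ Icc 0 s, h₁ t = h₂ t) :
    field l h₁ s = field l h₂ s := by
  unfold field
  congr 2
  refine intervalIntegral.integral_congr fun t ht => ?_
  rw [uIcc_of_le hs] at ht
  simp only [heq t ht]

lemma potential_congr {r : ℝ} (hr : 0 ≤ r) (heq : ∀ t ∈ Icc 0 r, h₁ t = h₂ t) :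
    potential l a h₁ r = potential l a h₂ r := by
  unfold potential
  congr 1
  refine intervalIntegral.integral_congr fun s hs => ?_
  rw [uIcc_of_le hr] at hs
  exact field_congr hs.1 fun t ht => heq t ⟨ht.1, ht.2.trans hs.2⟩

lemma intervalIntegrable_weight (hl : -1/2 < l) (s : ℝ) :
    IntervalIntegrable (fun t : ℝ => t ^ (2 + 2*l)) volume 0 s :=
  intervalIntegral.intervalIntegrable_rpow' (by linarith)

namespace BoundedSource

lemma bound_nonneg (hh : BoundedSource C h) : 0 ≤ C :=
  (hh.nonneg 0 le_rfl).trans (hh.le 0 le_rfl)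

lemma intervalIntegrable (hh : BoundedSource C h) (hl : -1/2 < l) {s : ℝ} (hs : 0 ≤ s) :
    IntervalIntegrable (fun t : ℝ => t ^ (2 + 2*l) * h t) volume 0 s := by
  refine ((intervalIntegrable_weight hl s).mul_const C).mono_fun ?_ ?_
  · rw [uIoc_of_le hs]
    have h1 : AEMeasurable h (volume.restrict (Ioc 0 s)) :=
      hh.aemeasurable.mono_set fun t ht => ht.1.le
    exact ((measurable_id.pow_const _).aemeasurable.mul h1).aestronglyMeasurable
  · rw [uIoc_of_le hs]
    refine (ae_restrict_iff' measurableSet_Ioc).2 (Eventually.of_forall fun t ht => ?_)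
    have h0 := ht.1.le
    beta_reduce
    rw [norm_mul, norm_mul, Real.norm_of_nonneg (hh.nonneg t h0),
      Real.norm_of_nonneg hh.bound_nonneg]
    exact mul_le_mul_of_nonneg_left (hh.le t h0) (norm_nonneg _)

lemma abs_field_sub_le (hl : -1/2 < l) (hh₁ : BoundedSource C h₁) (hh₂ : BoundedSource C h₂)
    {s M : ℝ} (hs : 0 ≤ s) (hM : ∀ t ∈ Icc 0 s, |h₁ t - h₂ t| ≤ M) :
    |field l h₁ s - field l h₂ s| ≤ 4 * π * s ^ (1 + 2*l) * M := by
  have hM0 : 0 ≤ M := (abs_nonneg _).trans (hM 0 ⟨le_rfl, hs⟩)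
  rcases hs.eq_or_lt with rfl | hs'
  · rw [field_zero, field_zero, sub_zero, abs_zero]
    have := rpow_nonneg (le_refl (0:ℝ)) (1 + 2*l)
    positivity
  have key : |∫ t in (0:ℝ)..s, (t ^ (2 + 2*l) * h₁ t - t ^ (2 + 2*l) * h₂ t)|
      ≤ s ^ (2 + 2*l) * M * |s - 0| := by
    rw [← Real.norm_eq_abs]
    refine intervalIntegral.norm_integral_le_of_norm_le_const fun t ht => ?_
    rw [uIoc_of_le hs] at ht
    rw [← mul_sub, norm_mul, Real.norm_of_nonneg (rpow_nonneg ht.1.le _)]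
    exact mul_le_mul (rpow_le_rpow ht.1.le ht.2 (by linarith)) (hM t ⟨ht.1.le, ht.2⟩)
      (norm_nonneg _) (rpow_nonneg hs _)
  rw [intervalIntegral.integral_sub (hh₁.intervalIntegrable hl hs)
    (hh₂.intervalIntegrable hl hs), sub_zero, abs_of_pos hs'] at key
  have hp : s ^ (2 + 2*l) = s ^ (1 + 2*l) * s := by
    rw [← rpow_add_one hs'.ne']; congr 1; ring
  unfold field
  rw [← sub_div, ← mul_sub, abs_div, abs_of_pos (pow_pos hs' 2), div_le_iff₀ (pow_pos hs' 2),
    abs_mul, abs_of_pos (by positivity : 0 < 4 * π)]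
  calc _ ≤ 4 * π * (s ^ (2 + 2*l) * M * s) := by gcongr
    _ = _ := by rw [hp]; ring

lemma zero (hC : 0 ≤ C) : BoundedSource C (fun _ => 0) :=
  ⟨aemeasurable_const, fun _ _ => le_rfl, fun _ _ => hC⟩

lemma field_le (hl : -1/2 < l) (hh : BoundedSource C h) {s : ℝ} (hs : 0 ≤ s) :
    |field l h s| ≤ 4 * π * s ^ (1 + 2*l) * C := by
  have := abs_field_sub_le hl hh (zero hh.bound_nonneg) hs (M := C) fun t ht => by
    rw [sub_zero, abs_of_nonneg (hh.nonneg t ht.1)]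
    exact hh.le t ht.1
  simpa [field] using this

lemma continuousOn_field (hl : -1/2 < l) (hh : BoundedSource C h) :
    ContinuousOn (field l h) (Ici 0) := by
  intro s hs
  rcases (mem_Ici.1 hs).eq_or_lt with rfl | hs'
  · unfold ContinuousWithinAt
    rw [field_zero, tendsto_zero_iff_abs_tendsto_zero]
    have hb : Tendsto (fun s : ℝ => 4 * π * s ^ (1 + 2*l) * C) (𝓝[Ici 0] 0) (𝓝 0) := by
      have : Continuous fun s : ℝ => 4 * π * s ^ (1 + 2*l) * C :=
        ((continuous_rpow_const (by linarith)).const_mul _).mul_const _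
      have := (this.tendsto 0).mono_left (nhdsWithin_le_nhds (s := Ici 0))
      rwa [zero_rpow (by linarith), mul_zero, zero_mul] at this
    exact tendsto_of_tendsto_of_tendsto_of_le_of_le' tendsto_const_nhds hb
      (Eventually.of_forall fun _ => abs_nonneg _)
      (eventually_nhdsWithin_of_forall fun s hs => field_le hl hh hs)
  · have h1 : ContinuousOn (fun s => ∫ t in (0:ℝ)..s, t ^ (2 + 2*l) * h t) (uIcc 0 (s + 1)) :=
      intervalIntegral.continuousOn_primitive_interval'
        (hh.intervalIntegrable hl (by linarith)) left_mem_uIcc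
    rw [uIcc_of_le (by linarith)] at h1
    have h2 := h1.continuousAt (Icc_mem_nhds hs' (by linarith))
    exact ((h2.const_mul (4 * π)).div (continuousAt_id.pow 2)
      (pow_pos hs' 2).ne').continuousWithinAt

lemma intervalIntegrable_field (hl : -1/2 < l) (hh : BoundedSource C h) {r s : ℝ} (hr : 0 ≤ r)
    (hs : 0 ≤ s) : IntervalIntegrable (field l h) volume r s :=
  ((continuousOn_field hl hh).mono fun _ ht => (le_min hr hs).trans ht.1).intervalIntegrable

lemma abs_potential_sub_le (hl : -1/2 < l) (hh₁ : BoundedSource C h₁)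
    (hh₂ : BoundedSource C h₂) {R M : ℝ} (k : ℕ) (hM0 : 0 ≤ M)
    (hM : ∀ t ∈ Icc 0 R, |h₁ t - h₂ t| ≤ M * t ^ k) {r : ℝ} (hr : r ∈ Icc 0 R) :
    |potential l a h₁ r - potential l a h₂ r| ≤
      4 * π * R ^ (1 + 2*l) * M * (r ^ (k + 1) / (k + 1)) := by
  have hi₁ := intervalIntegrable_field hl hh₁ le_rfl hr.1
  have hi₂ := intervalIntegrable_field hl hh₂ le_rfl hr.1
  have e : potential l a h₁ r - potential l a h₂ r =
      -∫ s in (0:ℝ)..r, (field l h₁ s - field l h₂ s) := by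
    rw [intervalIntegral.integral_sub hi₁ hi₂]
    unfold potential
    ring
  rw [e, abs_neg]
  calc _ ≤ ∫ s in (0:ℝ)..r, 4 * π * R ^ (1 + 2*l) * M * s ^ k := by
        rw [← Real.norm_eq_abs]
        refine intervalIntegral.norm_integral_le_of_norm_le hr.1 ?_ ?_
        · refine Eventually.of_forall fun s hs => ?_
          have hsR := hs.2.trans hr.2
          have := abs_field_sub_le hl hh₁ hh₂ hs.1.le (M := M * s ^ k) fun t ht =>
            (hM t ⟨ht.1, ht.2.trans hsR⟩).trans (by
              have := pow_le_pow_left₀ ht.1 ht.2 k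
              gcongr)
          refine this.trans ?_
          have h1 : s ^ (1 + 2*l) ≤ R ^ (1 + 2*l) :=
            rpow_le_rpow hs.1.le hsR (by linarith)
          have h2 : 0 ≤ M * s ^ k := mul_nonneg hM0 (pow_nonneg hs.1.le _)
          rw [mul_assoc _ M]
          gcongr
        · exact (continuous_const.mul (continuous_pow k)).intervalIntegrable _ _
    _ = _ := by
        rw [intervalIntegral.integral_const_mul, integral_pow]
        simp

lemma potential_regular (hl : -1/2 < l) (hh : BoundedSource C h) :
    ContDiffOn ℝ 1 (potential l a h) (Ici 0) ∧
      derivWithin (potential l a h) (Ici 0) 0 = 0 := by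
  set W : ℝ → ℝ := fun s => field l h (max s 0) with hW
  have hWc : Continuous W :=
    (continuousOn_field hl hh).comp_continuous (continuous_id.max continuous_const)
      fun _ => mem_Ici.2 (le_max_right _ _)
  set P : ℝ → ℝ := fun r => a - ∫ s in (0:ℝ)..r, W s
  have hP : ∀ r, HasDerivAt P (-W r) r := fun r =>
    (intervalIntegral.integral_hasDerivAt_right (hWc.intervalIntegrable _ _)
      (hWc.stronglyMeasurableAtFilter _ _) hWc.continuousAt).const_sub a
  have heq : EqOn (potential l a h) P (Ici 0) := by
    intro r hr
    unfold potential
    refine congrArg (a - ·) (intervalIntegral.integral_congr fun s hs => ?_)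
    rw [uIcc_of_le hr] at hs
    simp only [hW, max_eq_left hs.1]
  have hP1 : ContDiff ℝ 1 P := by
    rw [contDiff_one_iff_deriv]
    refine ⟨fun r => (hP r).differentiableAt, ?_⟩
    rw [show deriv P = fun r => -W r from funext fun r => (hP r).deriv]
    exact hWc.neg
  refine ⟨hP1.contDiffOn.congr heq, ?_⟩
  rw [derivWithin_congr heq (heq self_mem_Ici),
    (hP 0).hasDerivWithinAt.derivWithin (uniqueDiffOn_Ici 0 0 self_mem_Ici)]
  simp [hW, field_zero]

lemma antitoneOn_potential (hl : -1/2 < l) (hh : BoundedSource C h) :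
    AntitoneOn (potential l a h) (Ici 0) := by
  intro r hr s hs hrs
  have h1 := intervalIntegral.integral_add_adjacent_intervals
    (intervalIntegrable_field hl hh le_rfl hr) (intervalIntegrable_field hl hh hr hs)
  have h2 : 0 ≤ ∫ t in r..s, field l h t :=
    intervalIntegral.integral_nonneg hrs fun t ht =>
      field_nonneg hh.nonneg ((mem_Ici.1 hr).trans ht.1)
  unfold potential
  linarith

lemma comp_antitoneOn {G y : ℝ → ℝ} (hG : Continuous G) (hy : AntitoneOn y (Ici 0))
    (h0 : ∀ t ≥ (0:ℝ), 0 ≤ G (y t)) (h1 : ∀ t ≥ (0:ℝ), G (y t) ≤ C) :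
    BoundedSource C (G ∘ y) :=
  ⟨hG.measurable.comp_aemeasurable
    (aemeasurable_restrict_of_antitoneOn measurableSet_Ici hy), h0, h1⟩

lemma of_tendsto {H : ℕ → ℝ → ℝ} (hH : ∀ n, BoundedSource C (H n))
    (hlim : ∀ t ≥ (0:ℝ), Tendsto (fun n => H n t) atTop (𝓝 (h t))) : BoundedSource C h :=
  ⟨aemeasurable_of_tendsto_metrizable_ae atTop (fun n => (hH n).aemeasurable)
      ((ae_restrict_iff' measurableSet_Ici).2 (Eventually.of_forall hlim)),
    fun t ht => ge_of_tendsto' (hlim t ht) fun n => (hH n).nonneg t ht,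
    fun t ht => le_of_tendsto' (hlim t ht) fun n => (hH n).le t ht⟩

lemma tendsto_potential (hl : -1/2 < l) {H : ℕ → ℝ → ℝ} (hH : ∀ n, BoundedSource C (H n))
    (hlim : ∀ t ≥ (0:ℝ), Tendsto (fun n => H n t) atTop (𝓝 (h t))) {r : ℝ} (hr : 0 ≤ r) :
    Tendsto (fun n => potential l a (H n) r) atTop (𝓝 (potential l a h r)) := by
  have hC := (hH 0).bound_nonneg
  have hfield : ∀ s ≥ (0:ℝ), Tendsto (fun n => field l (H n) s) atTop (𝓝 (field l h s)) := by
    intro s hs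
    refine Tendsto.div_const (Tendsto.const_mul _ ?_) _
    refine intervalIntegral.tendsto_integral_filter_of_dominated_convergence
      (fun t => t ^ (2 + 2*l) * C) (Eventually.of_forall fun n => ?_)
      (Eventually.of_forall fun n => Eventually.of_forall fun t ht => ?_)
      ((intervalIntegrable_weight hl s).mul_const C)
      (Eventually.of_forall fun t ht => ?_)
    · exact ((hH n).intervalIntegrable hl hs).def'.aestronglyMeasurable
    · rw [uIoc_of_le hs] at ht
      rw [Real.norm_of_nonneg (mul_nonneg (rpow_nonneg ht.1.le _) ((hH n).nonneg t ht.1.le))]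
      exact mul_le_mul_of_nonneg_left ((hH n).le t ht.1.le) (rpow_nonneg ht.1.le _)
    · rw [uIoc_of_le hs] at ht
      exact (hlim t ht.1.le).const_mul _
  refine Tendsto.const_sub _ ?_
  refine intervalIntegral.tendsto_integral_filter_of_dominated_convergence
    (fun s => 4 * π * s ^ (1 + 2*l) * C) (Eventually.of_forall fun n => ?_)
    (Eventually.of_forall fun n => Eventually.of_forall fun s hs => ?_)
    (((intervalIntegral.intervalIntegrable_rpow' (by linarith)).const_mul _).mul_const _)
    (Eventually.of_forall fun s hs => ?_)
  · exact (intervalIntegrable_field hl (hH n) le_rfl hr).def'.aestronglyMeasurable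
  · rw [uIoc_of_le hr] at hs
    exact field_le hl (hH n) hs.1.le
  · rw [uIoc_of_le hr] at hs
    exact hfield s hs.1.le

lemma iterate_bound (hl : -1/2 < l) (hh₁ : BoundedSource C h₁) (hh₂ : BoundedSource C h₂)
    {k₁ k₂ : ℝ → ℝ} {L R : ℝ} (hL : 0 ≤ L) (n : ℕ)
    (hk : ∀ t ∈ Icc 0 R, |k₁ t - k₂ t| ≤ L * |potential l a h₁ t - potential l a h₂ t|)
    (hn : ∀ t ∈ Icc 0 R, |h₁ t - h₂ t| ≤
      C * ((L * (4 * π * R ^ (1 + 2*l)) * t) ^ n / n.factorial)) :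
    ∀ t ∈ Icc 0 R, |k₁ t - k₂ t| ≤
      C * ((L * (4 * π * R ^ (1 + 2*l)) * t) ^ (n + 1) / (n + 1).factorial) := by
  intro t ht
  have hC := hh₁.bound_nonneg
  have hR : 0 ≤ R ^ (1 + 2*l) := rpow_nonneg (ht.1.trans ht.2) _
  set A := 4 * π * R ^ (1 + 2*l) with hA
  have hA0 : 0 ≤ A := by positivity
  have h1 := abs_potential_sub_le (a := a) hl hh₁ hh₂ (R := R)
    (M := C * ((L * A) ^ n / n.factorial)) n (by positivity) (fun t ht => by
      refine (hn t ht).trans_eq ?_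
      rw [mul_pow]
      ring) ht
  refine (hk t ht).trans ((mul_le_mul_of_nonneg_left h1 hL).trans_eq ?_)
  rw [← hA, Nat.factorial_succ]
  push_cast
  have : (n.factorial : ℝ) ≠ 0 := by positivity
  have : (n : ℝ) + 1 ≠ 0 := by positivity
  field_simp
  ring

lemma abs_sub_le (hh₁ : BoundedSource C h₁) (hh₂ : BoundedSource C h₂) {t : ℝ} (ht : 0 ≤ t) :
    |h₁ t - h₂ t| ≤ C := by
  have := hh₁.nonneg t ht
  have := hh₁.le t ht
  have := hh₂.nonneg t ht
  have := hh₂.le t ht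
  rw [abs_le]
  constructor <;> linarith

lemma eqOn_of_lipschitz (hl : -1/2 < l) (hh₁ : BoundedSource C h₁) (hh₂ : BoundedSource C h₂)
    {L R : ℝ} (hL : 0 ≤ L)
    (hk : ∀ t ∈ Icc 0 R, |h₁ t - h₂ t| ≤ L * |potential l a h₁ t - potential l a h₂ t|) :
    ∀ t ∈ Icc 0 R, h₁ t = h₂ t := by
  have key : ∀ n : ℕ, ∀ t ∈ Icc 0 R, |h₁ t - h₂ t| ≤
      C * ((L * (4 * π * R ^ (1 + 2*l)) * t) ^ n / n.factorial) := by
    intro n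
    induction n with
    | zero => simpa using fun t ht _ => abs_sub_le hh₁ hh₂ ht
    | succ n ih => exact iterate_bound hl hh₁ hh₂ hL n hk ih
  intro t ht
  have h0 := (FloorSemiring.tendsto_pow_div_factorial_atTop
    (L * (4 * π * R ^ (1 + 2*l)) * t)).const_mul C
  rw [mul_zero] at h0
  have := ge_of_tendsto' h0 fun n => key n t ht
  exact sub_eq_zero.1 (abs_nonpos_iff.1 this)

/-- Picard iteration for a bounded, globally Lipschitz nonlinearity. -/
lemma exists_of_lipschitz (hl : -1/2 < l) {G : ℝ → ℝ} {L : ℝ} (hL : 0 ≤ L) (hGc : Continuous G)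
    (hG0 : ∀ u, 0 ≤ G u) (hGC : ∀ u, G u ≤ C) (hG : ∀ u v, |G u - G v| ≤ L * |u - v|) :
    ∃ h, BoundedSource C h ∧ ∀ t ≥ (0:ℝ), h t = G (potential l a h t) := by
  let H : ℕ → ℝ → ℝ := fun n => Nat.rec (fun _ => 0) (fun _ h => G ∘ potential l a h) n
  have hsucc : ∀ n, H (n + 1) = G ∘ potential l a (H n) := fun n => rfl
  have hH : ∀ n, BoundedSource C (H n) := by
    intro n
    induction n with
    | zero => exact zero ((hG0 0).trans (hGC 0))
    | succ n ih =>
      exact comp_antitoneOn hGc (antitoneOn_potential hl ih) (fun _ _ => hG0 _) fun _ _ => hGC _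
  have key : ∀ R, ∀ n : ℕ, ∀ t ∈ Icc 0 R, |H (n + 1) t - H n t| ≤
      C * ((L * (4 * π * R ^ (1 + 2*l)) * t) ^ n / n.factorial) := by
    intro R n
    induction n with
    | zero => simpa using fun t ht _ => abs_sub_le (hH 1) (hH 0) ht
    | succ n ih => exact iterate_bound hl (hH (n + 1)) (hH n) hL n (fun t _ => hG _ _) ih
  have hlim : ∀ t ≥ (0:ℝ), ∃ b, Tendsto (fun n => H n t) atTop (𝓝 b) := by
    intro t ht
    refine cauchySeq_tendsto_of_complete (cauchySeq_of_dist_le_of_summable _ (fun n => ?_)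
      ((Real.summable_pow_div_factorial (L * (4 * π * t ^ (1 + 2*l)) * t)).mul_left C))
    rw [dist_comm]
    exact key t n t ⟨ht, le_rfl⟩
  choose! h hh using hlim
  refine ⟨h, of_tendsto hH hh, fun t ht => ?_⟩
  have h1 := (hh t ht).comp (tendsto_add_atTop_nat 1)
  have h2 := (hGc.tendsto _).comp (tendsto_potential (a := a) hl hH hh ht)
  exact tendsto_nhds_unique h1 h2

/-- A solution for a Lipschitz nonlinearity `G` and a solution for a nonlinearity agreeing with
`G` above `ε` coincide as long as one of them stays above `ε`. -/
lemma potential_eq_of_agree (hl : -1/2 < l) {G : ℝ → ℝ} {L ε : ℝ} (hL : 0 ≤ L)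
    (hG : ∀ u v, |G u - G v| ≤ L * |u - v|) (hε : ε ≤ a)
    (hh₁ : BoundedSource C h₁) (hh₂ : BoundedSource C h₂)
    (e₁ : ∀ t ≥ (0:ℝ), h₁ t = G (potential l a h₁ t))
    (e₂ : ∀ t ≥ (0:ℝ), ε ≤ potential l a h₂ t → h₂ t = G (potential l a h₂ t))
    {r : ℝ} (hr : 0 ≤ r) (hlt : ε < potential l a h₁ r ∨ ε ≤ potential l a h₂ r) :
    potential l a h₂ r = potential l a h₁ r := by
  have main : ∀ r ≥ (0:ℝ), ε ≤ potential l a h₂ r →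
      potential l a h₂ r = potential l a h₁ r := by
    intro r hr hle
    refine potential_congr hr (eqOn_of_lipschitz (a := a) hl hh₂ hh₁ hL fun t ht => ?_)
    rw [e₁ t ht.1, e₂ t ht.1 (hle.trans (antitoneOn_potential hl hh₂ ht.1 hr ht.2))]
    exact hG _ _
  refine main r hr ?_
  rcases hlt with hlt | hle
  · by_contra! hcon
    have hcont : ContinuousOn (potential l a h₂) (Icc 0 r) :=
      (potential_regular hl hh₂).1.continuousOn.mono fun t ht => ht.1
    obtain ⟨t, ht, hte⟩ := intermediate_value_Icc' hr hcont
      ⟨hcon.le, by rwa [potential_zero]⟩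
    have h1 := main t ht.1 hte.ge
    have h2 := antitoneOn_potential (a := a) hl hh₁ ht.1 hr ht.2
    linarith
  · exact hle

/-- The source of a solution is bounded and measurable, without any regularity assumption on the
solution: where the outer integrand is not integrable, the solution is constant. -/
lemma of_solution {g z : ℝ → ℝ} (hgc : Continuous g) (hg0 : ∀ u, 0 ≤ g u)
    (hgC : ∀ u ≤ a, g u ≤ C) (hz : ∀ r ≥ (0:ℝ), z r = potential l a (g ∘ z) r) :
    BoundedSource C (g ∘ z) := by
  have hn : ∀ t ≥ (0:ℝ), 0 ≤ (g ∘ z) t := fun t _ => hg0 _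
  refine ⟨hgc.measurable.comp_aemeasurable ?_, hn,
    fun t ht => hgC _ (hz t ht ▸ potential_le hn ht)⟩
  set S : Set ℝ := {r | 0 ≤ r ∧ IntervalIntegrable (field l (g ∘ z)) volume 0 r}
  have hSm : MeasurableSet S := by
    refine OrdConnected.measurableSet ⟨fun x hx y hy t ht => ?_⟩
    have h0 := hx.1.trans ht.1
    refine ⟨h0, hy.2.mono_set ?_⟩
    rw [uIcc_of_le h0, uIcc_of_le hy.1]
    exact Icc_subset_Icc_right ht.2
  have hanti : AntitoneOn z S := by
    intro x hx y hy hxy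
    rw [hz x hx.1, hz y hy.1]
    have h1 := intervalIntegral.integral_add_adjacent_intervals hx.2 (hx.2.symm.trans hy.2)
    have h2 : 0 ≤ ∫ t in x..y, field l (g ∘ z) t :=
      intervalIntegral.integral_nonneg hxy fun t ht => field_nonneg hn (hx.1.trans ht.1)
    unfold potential
    linarith
  have hunion : Ici (0:ℝ) = S ∪ (Ici 0 \ S) := by
    rw [union_sdiff_cancel fun x hx => hx.1]
  rw [hunion, aemeasurable_union_iff]
  refine ⟨aemeasurable_restrict_of_antitoneOn hSm hanti, ?_⟩
  refine (aemeasurable_const (b := a)).congr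
    ((ae_restrict_iff' (measurableSet_Ici.diff hSm)).2 (Eventually.of_forall fun x hx => ?_))
  rw [hz x hx.1, potential, intervalIntegral.integral_undef fun hi => hx.2 ⟨hx.1, hi⟩, sub_zero]

end BoundedSource
end

theorem stmt13 (l : ℝ) (hl : -1/2 < l) (g : ℝ → ℝ) (hgc : Continuous g)
    (hgnn : ∀ z, 0 ≤ g z) (hg0 : ∀ z ≤ (0:ℝ), g z = 0)
    (hglip : ∀ K : Set ℝ, IsCompact K → K ⊆ Ioi 0 → ∃ L : NNReal, LipschitzOnWith L g K)
    (ya : ℝ) (hya : 0 < ya) :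
    ∃ y : ℝ → ℝ,
      (∀ r ≥ (0:ℝ), y r = ya - ∫ s in (0:ℝ)..r,
          (4 * π * ∫ t in (0:ℝ)..s, t ^ (2 + 2*l) * g (y t)) / s ^ 2) ∧
      ContDiffOn ℝ 1 y (Ici 0) ∧ AntitoneOn y (Ici 0) ∧
      derivWithin y (Ici 0) 0 = 0 ∧ (∀ r ≥ (0:ℝ), y r ≤ ya) ∧
      ∀ z : ℝ → ℝ, (∀ r ≥ (0:ℝ), z r = ya - ∫ s in (0:ℝ)..r,
          (4 * π * ∫ t in (0:ℝ)..s, t ^ (2 + 2*l) * g (z t)) / s ^ 2) →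
        ∀ r ≥ (0:ℝ), z r = y r := by
  obtain ⟨C, hC⟩ : ∃ C, ∀ u ≤ ya, g u ≤ C := by
    obtain ⟨C, hC⟩ := (isCompact_Icc (a := (0:ℝ)) (b := ya)).exists_bound_of_continuousOn
      hgc.continuousOn
    refine ⟨C, fun u hu => ?_⟩
    rcases le_total u 0 with h | h
    · rw [hg0 u h]
      exact (norm_nonneg _).trans (hC 0 ⟨le_rfl, hya.le⟩)
    · exact (le_abs_self _).trans (hC u ⟨h, hu⟩)
  -- The nonlinearity frozen below `ε` and above `ya` is globally Lipschitz.
  let G : ℝ → ℝ → ℝ := fun ε u => g (max ε (min u ya))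
  have hGle : ∀ ε ≤ ya, ∀ u, G ε u ≤ C := fun ε hε u => hC _ (max_le hε (min_le_right _ _))
  have hGc : ∀ ε, Continuous (G ε) := fun ε =>
    hgc.comp (continuous_const.max (continuous_id.min continuous_const))
  have hGeq : ∀ ε u, ε ≤ u → u ≤ ya → G ε u = g u := fun ε u h1 h2 => by
    simp only [G, min_eq_left h2, max_eq_right h1]
  have hGlip : ∀ ε, 0 < ε → ε ≤ ya → ∃ L : ℝ, 0 ≤ L ∧ ∀ u v, |G ε u - G ε v| ≤ L * |u - v| := by
    intro ε hε hεa
    obtain ⟨L, hL⟩ := hglip (Icc ε ya) isCompact_Icc fun u hu => hε.trans_le hu.1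
    refine ⟨L, L.2, fun u v => ?_⟩
    have hm : ∀ u, max ε (min u ya) ∈ Icc ε ya := fun u =>
      ⟨le_max_left _ _, max_le hεa (min_le_right _ _)⟩
    have h1 := hL.dist_le_mul _ (hm u) _ (hm v)
    rw [Real.dist_eq, Real.dist_eq] at h1
    refine h1.trans (mul_le_mul_of_nonneg_left ?_ L.2)
    rw [max_comm ε, max_comm ε]
    exact (abs_max_sub_max_le_abs _ _ _).trans (by
      simpa using abs_min_sub_min_le_max u ya v ya)
  have hex : ∀ ε, 0 < ε → ε ≤ ya → ∃ h, BoundedSource C h ∧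
      ∀ t ≥ (0:ℝ), h t = G ε (potential l ya h t) := fun ε hε hεa => by
    obtain ⟨L, hL, hLip⟩ := hGlip ε hε hεa
    exact BoundedSource.exists_of_lipschitz hl hL (hGc ε) (fun u => hgnn _) (hGle ε hεa) hLip
  choose! H hHb hHe using hex
  -- Comparison of the frozen solution with a solution agreeing with it above `ε`.
  have hcmp : ∀ ε, 0 < ε → ε ≤ ya → ∀ h, BoundedSource C h →
      (∀ t ≥ (0:ℝ), ε ≤ potential l ya h t → h t = g (potential l ya h t)) → ∀ r ≥ (0:ℝ),
      (ε < potential l ya (H ε) r ∨ ε ≤ potential l ya h r) →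
      potential l ya h r = potential l ya (H ε) r := by
    intro ε hε hεa h hh he r hr hlt
    obtain ⟨L, hL, hLip⟩ := hGlip ε hε hεa
    refine BoundedSource.potential_eq_of_agree hl hL hLip hεa (hHb ε hε hεa) hh
      (hHe ε hε hεa) (fun t ht hle => ?_) hr hlt
    rw [hGeq _ _ hle (potential_le hh.nonneg ht)]
    exact he t ht hle
  let e : ℕ → ℝ := fun n => ya / (n + 1)
  have he0 : ∀ n, 0 < e n := fun n => by positivity
  have hea : ∀ n, e n ≤ ya := fun n => div_le_self hya.le (by simp)
  have hemono : ∀ m n, m ≤ n → e n ≤ e m := fun m n hmn => by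
    have : (m:ℝ) ≤ n := by exact_mod_cast hmn
    exact div_le_div_of_nonneg_left hya.le (by positivity) (by linarith)
  have helim : Tendsto e atTop (𝓝 0) := by
    simpa [e, div_eq_mul_inv] using
      (tendsto_one_div_add_atTop_nhds_zero_nat (𝕜 := ℝ)).const_mul ya
  have hb : ∀ n, BoundedSource C (H (e n)) := fun n => hHb _ (he0 n) (hea n)
  have hconv : ∀ t ≥ (0:ℝ), ∃ b, Tendsto (fun n => H (e n) t) atTop (𝓝 b) := by
    intro t ht
    by_cases hc : ∃ n, e n < potential l ya (H (e n)) t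
    · obtain ⟨n, hn⟩ := hc
      refine ⟨H (e n) t, tendsto_const_nhds.congr' ?_⟩
      filter_upwards [eventually_ge_atTop n] with m hm
      have h1 := hcmp (e n) (he0 n) (hea n) (H (e m)) (hb m) (fun t ht hle => by
        rw [hHe _ (he0 m) (hea m) t ht, hGeq _ _ ((hemono n m hm).trans hle)
          (potential_le (hb m).nonneg ht)]) t ht (Or.inl hn)
      have hle := potential_le (l := l) (a := ya) (hb n).nonneg ht
      rw [hHe _ (he0 m) (hea m) t ht, hHe _ (he0 n) (hea n) t ht, h1,
        hGeq _ _ hn.le hle, hGeq _ _ ((hemono n m hm).trans hn.le) hle]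
    · push Not at hc
      refine ⟨g 0, ((hgc.tendsto 0).comp helim).congr fun n => ?_⟩
      rw [hHe _ (he0 n) (hea n) t ht]
      simp only [G, Function.comp, min_eq_left ((hc n).trans (hea n)), max_eq_left (hc n)]
  choose! h hh using hconv
  have hhb : BoundedSource C h := BoundedSource.of_tendsto hb hh
  have hhe : ∀ t ≥ (0:ℝ), h t = g (potential l ya h t) := by
    intro t ht
    have h1 := BoundedSource.tendsto_potential (a := ya) hl hb hh ht
    have h2 := (hgc.tendsto _).comp (helim.max (h1.min (tendsto_const_nhds (x := ya))))
    have h3 := tendsto_nhds_unique (hh t ht)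
      (h2.congr fun n => (hHe _ (he0 n) (hea n) t ht).symm)
    rw [h3, min_eq_left (potential_le hhb.nonneg ht)]
    rcases le_total (potential l ya h t) 0 with hneg | hpos
    · rw [max_eq_left hneg, hg0 _ le_rfl, hg0 _ hneg]
    · rw [max_eq_right hpos]
  obtain ⟨hreg, hderiv⟩ := BoundedSource.potential_regular (a := ya) hl hhb
  refine ⟨potential l ya h, fun r hr => ?_, hreg, BoundedSource.antitoneOn_potential hl hhb,
    hderiv, fun r hr => potential_le hhb.nonneg hr, fun z hz r hr => ?_⟩
  · exact potential_congr (h₂ := fun t => g (potential l ya h t)) hr fun t ht => hhe t ht.1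
  · have hz' : ∀ r ≥ (0:ℝ), z r = potential l ya (g ∘ z) r := hz
    have hzb := BoundedSource.of_solution hgc hgnn hC hz'
    have hze : ∀ t ≥ (0:ℝ), (g ∘ z) t = g (potential l ya (g ∘ z) t) := fun t ht => by
      rw [← hz' t ht, Function.comp]
    rw [hz' r hr]
    refine potential_congr hr fun t ht => ?_
    rw [hze t ht.1, hhe t ht.1]
    set p := potential l ya (g ∘ z) t with hp
    set q := potential l ya h t with hq
    by_cases hpq : 0 < max p q
    · obtain ⟨n, hn⟩ := (helim.eventually_lt_const hpq).exists
      have hcz := hcmp _ (he0 n) (hea n) _ hzb (fun t ht _ => hze t ht) t ht.1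
      have hch := hcmp _ (he0 n) (hea n) _ hhb (fun t ht _ => hhe t ht) t ht.1
      rw [← hp] at hcz
      rw [← hq] at hch
      rcases lt_max_iff.1 hn with h1 | h1
      · have h2 := hcz (Or.inr h1.le)
        rw [h2, hch (Or.inl (h2 ▸ h1))]
      · have h2 := hch (Or.inr h1.le)
        rw [h2, hcz (Or.inl (h2 ▸ h1))]
    · have := max_le_iff.1 (not_lt.1 hpq)
      rw [hg0 _ this.1, hg0 _ this.2]
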